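/- Let 0 < α ≤ 1 and let W be a committee of size k ≥ 1. If Δ*(W) < 1/(αk), then W satisfies α-OAS; that is, for every real λ ∈ [0,k] and every ((λ+1)/α)-large, λ-cohesive group of voters V, the average satisfaction satisfies avs_W(V) ≥ λ. -/

import Mathlib

open Finset

/-- The PAV score of a committee `W`: `(1/n) · Σ_i Σ_{j=1}^{|A_i ∩ W|} 1/j`. -/
noncomputable def pavSc {C : Type*} [DecidableEq C] (n : ℕ) (A : Fin n → Finset C)
    (W : Finset C) : ℝ :=
  (1 / (n : ℝ)) * ∑ i, ∑ j ∈ Finset.Icc 1 ((A i ∩ W).card), (1 : ℝ) / (j : ℝ)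

/-- `Δ(W,c) := pav-sc(W ∪ {c}) − pav-sc(W)`. -/
noncomputable def delta {C : Type*} [DecidableEq C] (n : ℕ) (A : Fin n → Finset C)
    (W : Finset C) (c : C) : ℝ :=
  pavSc n A (insert c W) - pavSc n A W

/-- `Δ*(W) := max_{c ∈ C} Δ(W,c)`. -/
noncomputable def deltaStar {C : Type*} [DecidableEq C] [Fintype C] [Nonempty C]
    (n : ℕ) (A : Fin n → Finset C) (W : Finset C) : ℝ :=
  Finset.univ.sup' Finset.univ_nonempty (delta n A W)

theorem delta_lower {C : Type*} [DecidableEq C] (n : ℕ) (A : Fin n → Finset C)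
    (W : Finset C) (c : C) (hc : c ∉ W) (V : Finset (Fin n)) (hV : ∀ i ∈ V, c ∈ A i) :
    (1 / (n : ℝ)) * ∑ i ∈ V, (1 : ℝ) / (((A i ∩ W).card : ℝ) + 1) ≤ delta n A W c := by
  unfold delta pavSc
  rw [← mul_sub, ← Finset.sum_sub_distrib]
  apply mul_le_mul_of_nonneg_left _ (by positivity)
  calc ∑ i ∈ V, (1 : ℝ) / (((A i ∩ W).card : ℝ) + 1)
      ≤ ∑ i ∈ V, (∑ j ∈ Finset.Icc 1 ((A i ∩ insert c W).card), (1 : ℝ) / (j : ℝ)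
          - ∑ j ∈ Finset.Icc 1 ((A i ∩ W).card), (1 : ℝ) / (j : ℝ)) := by
        apply Finset.sum_le_sum
        intro i hi
        have h1 : (A i ∩ insert c W).card = (A i ∩ W).card + 1 := by
          rw [Finset.inter_insert_of_mem (hV i hi), Finset.card_insert_of_notMem]
          simp [hc]
        rw [h1, Finset.sum_Icc_succ_top (by omega)]
        push_cast
        linarith
    _ ≤ _ := by
        apply Finset.sum_le_sum_of_subset_of_nonneg (Finset.subset_univ _)
        intro i _ _
        rw [sub_nonneg]
        apply Finset.sum_le_sum_of_subset_of_nonneg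
        · apply Finset.Icc_subset_Icc_right
          apply Finset.card_le_card
          exact Finset.inter_subset_inter_left (Finset.subset_insert _ _)
        · intros; positivity

/-- If `Δ*(W) < 1/(αk)` for a committee `W` of size `k ≥ 1` and `0 < α ≤ 1`, then `W`
satisfies α-OAS: for every real `λ ∈ [0,k]` and every `((λ+1)/α)`-large, `λ`-cohesive
group of voters `V`, the average satisfaction of `V` for `W` is at least `λ`. -/
theorem low_deltaStar_implies_alphaOAS {C : Type*} [DecidableEq C] [Fintype C] [Nonempty C]
    (n k : ℕ) (hn : 1 ≤ n) (hk : 1 ≤ k) (A : Fin n → Finset C)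
    (W : Finset C) (hW : W.card = k)
    (α : ℝ) (hα0 : 0 < α) (hα1 : α ≤ 1)
    (hΔ : deltaStar n A W < 1 / (α * k)) :
    ∀ lam : ℝ, 0 ≤ lam → lam ≤ (k : ℝ) → ∀ V : Finset (Fin n),
      ((lam + 1) / α) * (n : ℝ) / (k : ℝ) ≤ (V.card : ℝ) →
      lam ≤ ((V.inf A).card : ℝ) →
      lam ≤ (1 / (V.card : ℝ)) * ∑ i ∈ V, ((A i ∩ W).card : ℝ) := by
  intro lam h0 _ V hV hco
  have hn' : (0 : ℝ) < n := by exact_mod_cast hn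
  have hk' : (0 : ℝ) < k := by exact_mod_cast hk
  have hl : 0 < lam + 1 := by linarith
  have hVpos : (0 : ℝ) < V.card := lt_of_lt_of_le (by positivity) hV
  rw [one_div, inv_mul_eq_div, le_div_iff₀ hVpos]
  by_contra hlt
  push Not at hlt
  by_cases hsub : V.inf A ⊆ W
  · have : ∑ i ∈ V, lam ≤ ∑ i ∈ V, ((A i ∩ W).card : ℝ) := by
      apply Finset.sum_le_sum
      intro i hi
      refine hco.trans ?_
      exact_mod_cast Finset.card_le_card (Finset.subset_inter (Finset.inf_le hi) hsub)
    rw [Finset.sum_const, nsmul_eq_mul] at this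
    linarith
  · obtain ⟨c, hcV, hcW⟩ := Finset.not_subset.mp hsub
    have hd := delta_lower n A W c hcW V (fun i hi => (Finset.inf_le (f := A) hi) hcV)
    have hds : delta n A W c ≤ deltaStar n A W :=
      Finset.le_sup' (delta n A W) (Finset.mem_univ c)
    have hs : (V.card : ℝ) / (lam + 1) ≤ ∑ i ∈ V, (1 : ℝ) / (((A i ∩ W).card : ℝ) + 1) := by
      calc (V.card : ℝ) / (lam + 1)
          ≤ ((2 * lam + 1) * V.card - ∑ i ∈ V, ((A i ∩ W).card : ℝ)) / (lam + 1) ^ 2 := by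
            rw [div_le_div_iff₀ hl (by positivity)]
            nlinarith [mul_pos hl (sub_pos.mpr hlt)]
        _ = ∑ i ∈ V, ((2 * lam + 1) - ((A i ∩ W).card : ℝ)) / (lam + 1) ^ 2 := by
            rw [← Finset.sum_div, Finset.sum_sub_distrib, Finset.sum_const, nsmul_eq_mul]
            ring
        _ ≤ _ := by
            apply Finset.sum_le_sum
            intro i _
            have hu : (0 : ℝ) ≤ ((A i ∩ W).card : ℝ) := by positivity
            rw [div_le_div_iff₀ (by positivity) (by positivity)]
            nlinarith [sq_nonneg (lam - ((A i ∩ W).card : ℝ))]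
    have h1 : 1 / (α * k) ≤ (1 / (n : ℝ)) * ((V.card : ℝ) / (lam + 1)) := by
      have h2 : 1 / (α * k) = (1 / (n : ℝ)) * (((lam + 1) / α * n / k) / (lam + 1)) := by
        field_simp
      rw [h2]
      gcongr
    have h3 : (1 / (n : ℝ)) * ((V.card : ℝ) / (lam + 1)) ≤
        (1 / (n : ℝ)) * ∑ i ∈ V, (1 : ℝ) / (((A i ∩ W).card : ℝ) + 1) :=
      mul_le_mul_of_nonneg_left hs (by positivity)
    linarith
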